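/- Let x ∈ JT be a positive vector (x ≥ 0) and a ∈ supp(x). Assume that for every child c of a and for every segment s_c ⊆ W_c with min s_c = c and S_{s_c}(x) = S_c(x), there exists an x_c-norming partition containing the segment s_c. Then ‖x_a‖_{JT}² = x(a)² + 2·x(a)·S_{c₀}(x) + ∑_{c child of a} ‖x_c‖_{JT}², where c₀ is a child of a maximizing S_{c₀}(x) among the children of a. -/

import Mathlib

/-! Common framework for the James Tree space `JT`.

The dyadic tree is modelled as `List Bool`, ordered by `List.IsPrefix` (`<+:`). -/

abbrev DyadicNode := List Bool

namespace JTSpace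

/-- A segment of the dyadic tree: a linearly ordered, order-convex subset. -/
def IsSegment (S : Set DyadicNode) : Prop :=
  (∀ a ∈ S, ∀ b ∈ S, a <+: b ∨ b <+: a) ∧
  (∀ a ∈ S, ∀ b ∈ S, ∀ c : DyadicNode, a <+: c → c <+: b → c ∈ S)

/-- A partition: a family of pairwise disjoint segments. -/
def IsPartition (P : Set (Set DyadicNode)) : Prop :=
  (∀ S ∈ P, IsSegment S) ∧ P.PairwiseDisjoint id

/-- The sum of `x` along a set of nodes. -/
noncomputable def segSum (x : DyadicNode → ℝ) (S : Set DyadicNode) : ℝ :=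
  ∑' a : S, x a

/-- The square of the value `‖x‖_P` of `x` on the partition `P`. -/
noncomputable def pNormSq (x : DyadicNode → ℝ) (P : Set (Set DyadicNode)) : ℝ :=
  ∑' S : P, (segSum x S) ^ 2

/-- The set of all values `‖x‖_P²` over partitions `P`. -/
def normSqSet (x : DyadicNode → ℝ) : Set ℝ :=
  {r | ∃ P, IsPartition P ∧ r = pNormSq x P}

/-- The square of the `JT` norm. -/
noncomputable def JTnormSq (x : DyadicNode → ℝ) : ℝ := sSup (normSqSet x)

/-- The `JT` norm of `x`. -/
noncomputable def JTnorm (x : DyadicNode → ℝ) : ℝ := Real.sqrt (JTnormSq x)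

/-- The `ℓ₂` norm of `x`. -/
noncomputable def l2norm (x : DyadicNode → ℝ) : ℝ := Real.sqrt (∑' a, (x a) ^ 2)

def HasBddNorm (x : DyadicNode → ℝ) : Prop := BddAbove (normSqSet x)

/-- `x` belongs to the James Tree space: its norm is finite and it is approximable in the
`JT` norm by finitely supported functions (`JT` is the completion of `c₀₀(T)`). -/
def MemJT (x : DyadicNode → ℝ) : Prop :=
  HasBddNorm x ∧
  ∀ ε > (0 : ℝ), ∃ y : DyadicNode → ℝ, (Function.support y).Finite ∧
    HasBddNorm (x - y) ∧ JTnorm (x - y) ≤ ε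

/-- An `x`-norming partition. -/
def IsNormingPartition (x : DyadicNode → ℝ) (P : Set (Set DyadicNode)) : Prop :=
  IsPartition P ∧ pNormSq x P = JTnormSq x

/-- A complete subtree of the dyadic tree. -/
def IsCompleteSubtree (K : Set DyadicNode) : Prop :=
  ∀ a ∈ K, ∀ b ∈ K, ∀ c : DyadicNode, a <+: c → c <+: b → c ∈ K

/-- The range of `x`: the smallest complete subtree containing the support of `x`. -/
def ran (x : DyadicNode → ℝ) : Set DyadicNode :=
  ⋂₀ {K | IsCompleteSubtree K ∧ Function.support x ⊆ K}

/-- `x` is separated: every two distinct nodes of `ran x` are separated by some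
`x`-norming partition. -/
def Separated (x : DyadicNode → ℝ) : Prop :=
  ∀ a ∈ ran x, ∀ b ∈ ran x, a ≠ b →
    ∃ P, IsNormingPartition x P ∧ ∃ S ∈ P, ∃ S' ∈ P, S ≠ S' ∧ a ∈ S ∧ b ∈ S'

/-- `x` is an extreme point of the ball of radius `‖x‖_{JT}`. -/
def IsExtremePoint (x : DyadicNode → ℝ) : Prop :=
  x ≠ 0 ∧
  ∀ y z : DyadicNode → ℝ, MemJT y → MemJT z →
    ∀ l : ℝ, 0 < l → l < 1 → x = l • y + (1 - l) • z →
      JTnorm y = JTnorm x → JTnorm z = JTnorm x → y = x ∧ z = x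

/-- A branch: a maximal segment. -/
def IsBranch (b : Set DyadicNode) : Prop :=
  IsSegment b ∧ ∀ S : Set DyadicNode, IsSegment S → b ⊆ S → S = b

/-- The wedge rooted at `a`. -/
def wedge (a : DyadicNode) : Set DyadicNode := {b | a <+: b}

/-- The two children of a node. -/
def children (u : DyadicNode) : Set DyadicNode := {u ++ [false], u ++ [true]}

/-- The maximal segment sum starting at `a`:
`S_a(x) = sup { S_s(x) : s a segment with min s = a }`. -/
noncomputable def maxSum (x : DyadicNode → ℝ) (a : DyadicNode) : ℝ :=
  sSup {r | ∃ s : Set DyadicNode, IsSegment s ∧ a ∈ s ∧ (∀ b ∈ s, a <+: b) ∧ r = segSum x s}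

/-- The children of `u` within the subtree spanned by the support of `x`. -/
def supportedChildren (x : DyadicNode → ℝ) (u : DyadicNode) : Set DyadicNode :=
  {c ∈ children u | ∃ b ∈ Function.support x, c <+: b}

/-- A greedy partition for a positive vector `x`: a partition whose segments cover the
support of `x` and such that every segment, at every support node `u` which has a strict
descendant in the support, continues through a child of `u` (within the subtree spanned by
the support) maximizing the maximal segment sum, down to the next element of the support;
at support nodes with no strict descendant in the support, the segment's support ends. -/
def IsGreedyPartition (x : DyadicNode → ℝ) (P : Set (Set DyadicNode)) : Prop :=
  IsPartition P ∧ Function.support x ⊆ ⋃₀ P ∧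
  ∀ s ∈ P, ∀ u ∈ s ∩ Function.support x,
    ((∃ w ∈ Function.support x, u <+: w ∧ u ≠ w) →
      ∃ v ∈ s ∩ Function.support x, u <+: v ∧ u ≠ v ∧
        (∀ w ∈ s ∩ Function.support x, u <+: w → u ≠ w → v <+: w) ∧
        ∃ c ∈ supportedChildren x u, c <+: v ∧
          ∀ k ∈ supportedChildren x u, maxSum x k ≤ maxSum x c) ∧
    ((¬ ∃ w ∈ Function.support x, u <+: w ∧ u ≠ w) →
      ∀ w ∈ s ∩ Function.support x, w <+: u)


/-! ### Helper lemmas -/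

lemma segSum_eq (x : DyadicNode → ℝ) (S : Set DyadicNode) :
    segSum x S = ∑' b, S.indicator x b := tsum_subtype S x

lemma segSum_indicator (x : DyadicNode → ℝ) (W S : Set DyadicNode) :
    segSum (W.indicator x) S = segSum x (S ∩ W) := by
  rw [segSum_eq, segSum_eq, Set.indicator_indicator]

lemma segSum_empty (x : DyadicNode → ℝ) : segSum x ∅ = 0 := by
  rw [segSum_eq]; simp

lemma segSum_nonneg {x : DyadicNode → ℝ} (hpos : ∀ a, 0 ≤ x a) (S : Set DyadicNode) :
    0 ≤ segSum x S := tsum_nonneg fun _ => hpos _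

lemma isSegment_empty : IsSegment ∅ := ⟨by simp, by simp⟩

lemma isSegment_inter_wedge {S : Set DyadicNode} (hS : IsSegment S) (a : DyadicNode) :
    IsSegment (S ∩ wedge a) :=
  ⟨fun u hu v hv => hS.1 u hu.1 v hv.1,
    fun u hu v hv c huc hcv => ⟨hS.2 u hu.1 v hv.1 c huc hcv, List.IsPrefix.trans hu.2 huc⟩⟩

lemma fam_le {x : DyadicNode → ℝ} (hb : HasBddNorm x) {ι : Type*} (F : Finset ι)
    (S : ι → Set DyadicNode) (hS : ∀ i ∈ F, IsSegment (S i))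
    (hd : ∀ i ∈ F, ∀ j ∈ F, i ≠ j → Disjoint (S i) (S j)) :
    ∑ i ∈ F, (segSum x (S i)) ^ 2 ≤ JTnormSq x := by
  classical
  set G := F.filter (fun i => (S i).Nonempty) with hG
  have h1 : ∑ i ∈ F, (segSum x (S i)) ^ 2 = ∑ i ∈ G, (segSum x (S i)) ^ 2 := by
    symm
    apply Finset.sum_subset (Finset.filter_subset _ _)
    intro i hi hi'
    have : S i = ∅ := by
      by_contra h
      exact hi' (Finset.mem_filter.2 ⟨hi, Set.nonempty_iff_ne_empty.2 h⟩)
    rw [this, segSum_empty]; simp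
  have hinj : ∀ i ∈ G, ∀ j ∈ G, S i = S j → i = j := by
    intro i hi j hj hij
    by_contra hne
    have := hd i (Finset.mem_filter.1 hi).1 j (Finset.mem_filter.1 hj).1 hne
    rw [← hij, disjoint_self] at this
    exact (Finset.mem_filter.1 hi).2.ne_empty this
  have h2 : ∑ i ∈ G, (segSum x (S i)) ^ 2 = ∑ T ∈ G.image S, (segSum x T) ^ 2 := by
    rw [Finset.sum_image]
    intro i hi j hj hij
    exact hinj i hi j hj hij
  rw [h1, h2]
  apply le_csSup hb
  refine ⟨((G.image S : Finset (Set DyadicNode)) : Set (Set DyadicNode)), ⟨?_, ?_⟩, ?_⟩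
  · intro T hT
    obtain ⟨i, hi, rfl⟩ := Finset.mem_image.1 (Finset.mem_coe.1 hT)
    exact hS i (Finset.mem_filter.1 hi).1
  · intro T hT T' hT' hne
    obtain ⟨i, hi, rfl⟩ := Finset.mem_image.1 (Finset.mem_coe.1 hT)
    obtain ⟨j, hj, rfl⟩ := Finset.mem_image.1 (Finset.mem_coe.1 hT')
    exact hd i (Finset.mem_filter.1 hi).1 j (Finset.mem_filter.1 hj).1
      (fun h => hne (by rw [h]))
  · unfold pNormSq
    exact (Finset.tsum_subtype' (G.image S) (fun T => (segSum x T) ^ 2)).symm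

lemma seg_sq_le {x : DyadicNode → ℝ} (hb : HasBddNorm x) {S : Set DyadicNode}
    (hS : IsSegment S) : (segSum x S) ^ 2 ≤ JTnormSq x := by
  have := fam_le hb ({()} : Finset Unit) (fun _ => S) (fun _ _ => hS)
    (fun i _ j _ h => (h rfl).elim)
  simpa using this

lemma JTnormSq_nonneg (x : DyadicNode → ℝ) : 0 ≤ JTnormSq x := by
  apply Real.sSup_nonneg
  rintro r ⟨P, _, rfl⟩
  exact tsum_nonneg fun _ => sq_nonneg _

lemma JTnorm_sq (x : DyadicNode → ℝ) : JTnorm x ^ 2 = JTnormSq x :=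
  Real.sq_sqrt (JTnormSq_nonneg x)

lemma pNormSq_le_of {x : DyadicNode → ℝ} {P : Set (Set DyadicNode)} {C : ℝ}
    (h : ∀ F : Finset P, ∑ S ∈ F, (segSum x S) ^ 2 ≤ C) : pNormSq x P ≤ C := by
  apply tsum_le_of_sum_le' _ h
  simpa using h ∅

lemma pNormSq_indicator_le {x : DyadicNode → ℝ} (hb : HasBddNorm x) (a : DyadicNode)
    {P : Set (Set DyadicNode)} (hP : IsPartition P) :
    pNormSq ((wedge a).indicator x) P ≤ JTnormSq x := by
  apply pNormSq_le_of
  intro F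
  simp only [segSum_indicator]
  apply fam_le hb F (fun S : P => (S : Set DyadicNode) ∩ wedge a)
  · intro S _
    exact isSegment_inter_wedge (hP.1 S S.2) a
  · intro S _ T _ hne
    have := hP.2 S.2 T.2 (fun h => hne (Subtype.ext h))
    exact Disjoint.mono Set.inter_subset_left Set.inter_subset_left this

lemma bdd_indicator {x : DyadicNode → ℝ} (hb : HasBddNorm x) (a : DyadicNode) :
    HasBddNorm ((wedge a).indicator x) := by
  refine ⟨JTnormSq x, ?_⟩
  rintro r ⟨P, hP, rfl⟩
  exact pNormSq_indicator_le hb a hP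

lemma seg_summable {x : DyadicNode → ℝ} (hb : HasBddNorm x) (hpos : ∀ a, 0 ≤ x a)
    {S : Set DyadicNode} (hS : IsSegment S) : Summable (S.indicator x) := by
  classical
  apply summable_of_sum_le (c := Real.sqrt (JTnormSq x))
    (fun b => Set.indicator_nonneg (fun b _ => hpos b) b)
  intro u
  set T : Set DyadicNode := {b | b ∈ S ∧ ∃ e ∈ u, e ∈ S ∧ b <+: e} with hT
  have hTfin : T.Finite := by
    apply Set.Finite.subset (u.finite_toSet.biUnion fun e _ => e.inits.finite_toSet)
    rintro b ⟨_, e, he, _, hbe⟩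
    simp only [Set.mem_iUnion]
    exact ⟨e, he, by simpa using hbe⟩
  have hTseg : IsSegment T := by
    refine ⟨fun p hp q hq => hS.1 p hp.1 q hq.1, ?_⟩
    rintro p ⟨hp, -⟩ q ⟨hq, e, he, heS, hqe⟩ c hpc hcq
    exact ⟨hS.2 p hp q hq c hpc hcq, e, he, heS, hcq.trans hqe⟩
  have h1 : ∑ b ∈ u, S.indicator x b ≤ segSum x T := by
    have : ∑ b ∈ u, S.indicator x b ≤ ∑ b ∈ u, T.indicator x b := by
      apply Finset.sum_le_sum
      intro b hb'
      by_cases hbS : b ∈ S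
      · have : b ∈ T := ⟨hbS, b, hb', hbS, List.prefix_rfl⟩
        simp [hbS, this]
      · rw [Set.indicator_of_notMem hbS]
        exact Set.indicator_nonneg (fun b _ => hpos b) b
    refine this.trans ?_
    rw [segSum_eq]
    apply Summable.sum_le_tsum
    · intro b _
      exact Set.indicator_nonneg (fun b _ => hpos b) b
    · apply summable_of_hasFiniteSupport
      exact hTfin.subset (Set.support_indicator_subset)
  exact h1.trans (Real.le_sqrt_of_sq_le (seg_sq_le hb hTseg))

/-! ### Branches through a node -/

/-- the `n`-th node of the branch above `c` coded by `f` -/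
def path (c : DyadicNode) (f : ℕ → Bool) (n : ℕ) : DyadicNode :=
  c ++ List.ofFn (fun i : Fin n => f i)

/-- the branch above `c` coded by `f` -/
def br (c : DyadicNode) (f : ℕ → Bool) : Set DyadicNode := Set.range (path c f)

lemma path_length (c : DyadicNode) (f : ℕ → Bool) (n : ℕ) :
    (path c f n).length = c.length + n := by simp [path]

lemma path_prefix (c : DyadicNode) (f : ℕ → Bool) {m n : ℕ} (h : m ≤ n) :
    path c f m <+: path c f n := by
  unfold path
  rw [List.prefix_append_right_inj]
  obtain ⟨k, rfl⟩ := Nat.exists_eq_add_of_le h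
  rw [List.ofFn_add]
  exact List.prefix_append _ _

lemma mem_br_iff (c : DyadicNode) (f : ℕ → Bool) (b : DyadicNode) :
    b ∈ br c f ↔ path c f (b.length - c.length) = b := by
  constructor
  · rintro ⟨n, rfl⟩
    rw [path_length]; simp
  · intro h; exact ⟨_, h⟩

lemma br_sub (c : DyadicNode) (f : ℕ → Bool) : ∀ b ∈ br c f, c <+: b := by
  rintro b ⟨n, rfl⟩
  exact List.prefix_append _ _

lemma self_mem_br (c : DyadicNode) (f : ℕ → Bool) : c ∈ br c f := ⟨0, by simp [path]⟩

lemma br_segment (c : DyadicNode) (f : ℕ → Bool) : IsSegment (br c f) := by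
  constructor
  · rintro _ ⟨m, rfl⟩ _ ⟨n, rfl⟩
    rcases le_total m n with h | h
    · exact Or.inl (path_prefix c f h)
    · exact Or.inr (path_prefix c f h)
  · rintro _ ⟨m, rfl⟩ _ ⟨n, rfl⟩ e h1 h2
    have hl : c.length ≤ e.length := by
      have := h1.length_le
      rw [path_length] at this; omega
    have hl2 : e.length ≤ c.length + n := by
      have := h2.length_le
      rwa [path_length] at this
    refine ⟨e.length - c.length, ?_⟩
    have h3 : path c f (e.length - c.length) <+: path c f n := path_prefix c f (by omega)
    have hlen : (path c f (e.length - c.length)).length = e.length := by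
      rw [path_length]; omega
    exact (List.prefix_of_prefix_length_le h3 h2 hlen.le).eq_of_length hlen

lemma prefix_getElem_opt {u v : DyadicNode} (h : u <+: v) {i : ℕ} {t : Bool}
    (hu : u[i]? = some t) : v[i]? = some t := by
  obtain ⟨w, rfl⟩ := h
  obtain ⟨hi, -⟩ := List.getElem?_eq_some_iff.1 hu
  rw [List.getElem?_append_left hi, hu]

open Classical in
lemma exists_br (c : DyadicNode) (s : Set DyadicNode) (hs : IsSegment s)
    (hc : ∀ b ∈ s, c <+: b) : ∃ f, s ⊆ br c f := by
  refine ⟨fun n => decide (∃ b ∈ s, b[c.length + n]? = some true), ?_⟩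
  intro b hb
  rw [mem_br_iff]
  obtain ⟨t, rfl⟩ := hc b hb
  unfold path
  congr 1
  apply List.ext_getElem
  · simp
  · intro i h1 h2
    simp only [List.getElem_ofFn]
    have key : (c ++ t)[c.length + i]? = some t[i] := by
      rw [List.getElem?_append_right (by omega)]
      simp [h2]
    cases hti : t[i] with
    | true =>
      rw [decide_eq_true_iff]
      exact ⟨c ++ t, hb, by rw [key, hti]⟩
    | false =>
      rw [decide_eq_false_iff_not]
      rintro ⟨b, hbs, hbt⟩
      rw [hti] at key
      rcases hs.1 b hbs _ hb with h | h
      · have := prefix_getElem_opt h hbt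
        rw [key] at this; simp at this
      · have := prefix_getElem_opt h key
        rw [hbt] at this; simp at this

lemma summable_subset {x : DyadicNode → ℝ} (hb : HasBddNorm x) (hpos : ∀ a, 0 ≤ x a)
    {S T : Set DyadicNode} (hT : IsSegment T) (hST : S ⊆ T) : Summable (S.indicator x) :=
  Summable.of_nonneg_of_le (fun b => Set.indicator_nonneg (fun b _ => hpos b) b)
    (fun b => Set.indicator_le_indicator_of_subset hST hpos b)
    (seg_summable hb hpos hT)

lemma segSum_mono {x : DyadicNode → ℝ} (hb : HasBddNorm x) (hpos : ∀ a, 0 ≤ x a)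
    {S T : Set DyadicNode} (hT : IsSegment T) (hST : S ⊆ T) : segSum x S ≤ segSum x T := by
  rw [segSum_eq, segSum_eq]
  exact Summable.tsum_le_tsum (fun b => Set.indicator_le_indicator_of_subset hST hpos b)
    (summable_subset hb hpos hT hST) (seg_summable hb hpos hT)

lemma continuous_br_finite (c : DyadicNode) (y : DyadicNode → ℝ)
    (hy : (Function.support y).Finite) : Continuous (fun f => segSum y (br c f)) := by
  classical
  have h : (fun f => segSum y (br c f)) =
      fun f => ∑ b ∈ hy.toFinset, (br c f).indicator y b := by
    funext f
    rw [segSum_eq]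
    apply tsum_eq_sum
    intro b hb
    have : y b = 0 := by simpa using hb
    simp [Set.indicator, this]
  rw [h]
  apply continuous_finsetSum
  intro b _
  have h2 : (fun f => (br c f).indicator y b) =
      (fun g : Fin (b.length - c.length) → Bool =>
        if c ++ List.ofFn g = b then y b else 0) ∘
      (fun (f : ℕ → Bool) (i : Fin (b.length - c.length)) => f i) := by
    funext f
    have := mem_br_iff c f b
    unfold path at this
    simp only [Set.indicator, Function.comp, this]
  rw [h2]
  apply continuous_of_discreteTopology.comp
  fun_prop

lemma continuous_br {x : DyadicNode → ℝ} (hx : MemJT x) (hpos : ∀ a, 0 ≤ x a)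
    (c : DyadicNode) : Continuous (fun f => segSum x (br c f)) := by
  apply continuous_of_uniform_approx_of_continuous
  rw [Metric.uniformity_basis_dist_le.forall_iff
    (fun _ _ h ⟨F, hF, hF'⟩ => ⟨F, hF, fun y => h (hF' y)⟩)]
  intro ε hε
  obtain ⟨y, hyfin, hyb, hyn⟩ := hx.2 ε hε
  refine ⟨_, continuous_br_finite c y hyfin, fun f => ?_⟩
  change dist (segSum x (br c f)) (segSum y (br c f)) ≤ ε
  have hsy : Summable ((br c f).indicator y) := by
    apply summable_of_hasFiniteSupport
    apply hyfin.subset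
    intro b hb hb'
    exact hb (by simp [Set.indicator, hb'])
  have h1 : segSum (x - y) (br c f) = segSum x (br c f) - segSum y (br c f) := by
    rw [segSum_eq, segSum_eq, segSum_eq, Set.indicator_sub',
      ← (seg_summable hx.1 hpos (br_segment c f)).tsum_sub hsy]
    rfl
  rw [Real.dist_eq, ← h1]
  exact (Real.abs_le_sqrt (seg_sq_le hyb (br_segment c f))).trans hyn

lemma exists_max {x : DyadicNode → ℝ} (hx : MemJT x) (hpos : ∀ a, 0 ≤ x a)
    (c : DyadicNode) : ∃ s : Set DyadicNode, IsSegment s ∧ c ∈ s ∧ (∀ b ∈ s, c <+: b) ∧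
      segSum x s = maxSum x c ∧
      ∀ t : Set DyadicNode, IsSegment t → (∀ b ∈ t, c <+: b) → segSum x t ≤ maxSum x c := by
  obtain ⟨f, -, hf⟩ := isCompact_univ.exists_isMaxOn (Set.univ_nonempty (α := ℕ → Bool))
    (continuous_br hx hpos c).continuousOn
  have hle : ∀ t : Set DyadicNode, IsSegment t → (∀ b ∈ t, c <+: b) →
      segSum x t ≤ segSum x (br c f) := by
    intro t ht htc
    obtain ⟨g, hg⟩ := exists_br c t ht htc
    exact (segSum_mono hx.1 hpos (br_segment c g) hg).trans (hf (Set.mem_univ g))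
  have heq : maxSum x c = segSum x (br c f) := by
    apply IsGreatest.csSup_eq
    refine ⟨⟨br c f, br_segment c f, self_mem_br c f, br_sub c f, rfl⟩, ?_⟩
    rintro r ⟨t, ht, -, htc, rfl⟩
    exact hle t ht htc
  refine ⟨br c f, br_segment c f, self_mem_br c f, br_sub c f, heq.symm, ?_⟩
  rw [heq]
  exact hle

/-! ### Splitting a wedge at its root -/

lemma child_cases {a b : DyadicNode} (i : Bool) (h : a <+: b) :
    b = a ∨ a ++ [i] <+: b ∨ a ++ [!i] <+: b := by
  obtain ⟨t, rfl⟩ := h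
  cases t with
  | nil => left; simp
  | cons j t =>
    right
    have : a ++ [j] <+: a ++ j :: t := ⟨t, by simp⟩
    cases i <;> cases j <;> simp_all

lemma child_ne {a b : DyadicNode} {i : Bool} (h1 : a ++ [i] <+: b) (h2 : a ++ [!i] <+: b) :
    False := by
  have := (List.prefix_of_prefix_length_le h1 h2 (by simp)).eq_of_length (by simp)
  simp at this

lemma self_not_child {a : DyadicNode} {i : Bool} (h : a ++ [i] <+: a) : False := by
  have := h.length_le
  simp at this

lemma seg_one_side {S : Set DyadicNode} (hS : IsSegment S) (a : DyadicNode) (i : Bool) :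
    S ∩ wedge (a ++ [i]) = ∅ ∨ S ∩ wedge (a ++ [!i]) = ∅ := by
  by_contra h
  push Not at h
  obtain ⟨⟨u, huS, hu⟩, ⟨v, hvS, hv⟩⟩ := h
  rcases hS.1 u huS v hvS with h | h
  · exact child_ne (List.IsPrefix.trans hu h) hv
  · exact child_ne hu (List.IsPrefix.trans hv h)

open Classical in
lemma segSum_split {x : DyadicNode → ℝ} (hb : HasBddNorm x) (hpos : ∀ a, 0 ≤ x a)
    {S : Set DyadicNode} (hS : IsSegment S) (a : DyadicNode) (i : Bool) :
    segSum x (S ∩ wedge a) = (if a ∈ S then x a else 0)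
      + segSum x (S ∩ wedge (a ++ [i])) + segSum x (S ∩ wedge (a ++ [!i])) := by
  have h0 : (if a ∈ S then x a else 0) = segSum x (S ∩ {a}) := by
    rw [segSum_eq, tsum_eq_single a]
    · simp [Set.indicator]
    · intro b hb'
      simp [Set.indicator, hb']
  rw [h0, segSum_eq, segSum_eq, segSum_eq, segSum_eq,
    ← (summable_subset hb hpos hS Set.inter_subset_left).tsum_add
      (summable_subset hb hpos hS Set.inter_subset_left),
    ← ((summable_subset hb hpos hS Set.inter_subset_left).add
      (summable_subset hb hpos hS Set.inter_subset_left)).tsum_add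
      (summable_subset hb hpos hS Set.inter_subset_left)]
  congr 1
  funext b
  by_cases hbS : b ∈ S
  · by_cases hba : a <+: b
    · rcases child_cases i hba with rfl | h | h
      · have h1 : ¬ (b ++ [i] <+: b) := self_not_child
        have h2 : ¬ (b ++ [!i] <+: b) := self_not_child
        simp only [Set.indicator, Set.mem_inter_iff, wedge, Set.mem_ofPred_eq,
          Set.mem_singleton_iff, hbS, hba, h1, h2]
        simp
      · have h1 : b ≠ a := by rintro rfl; exact self_not_child h
        have h2 : ¬ (a ++ [!i] <+: b) := fun h' => child_ne h h'
        simp only [Set.indicator, Set.mem_inter_iff, wedge, Set.mem_ofPred_eq,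
          Set.mem_singleton_iff, hbS, hba, h, h1, h2]
        simp
      · have h1 : b ≠ a := by rintro rfl; exact self_not_child h
        have h2 : ¬ (a ++ [i] <+: b) := fun h' => child_ne h' h
        simp only [Set.indicator, Set.mem_inter_iff, wedge, Set.mem_ofPred_eq,
          Set.mem_singleton_iff, hbS, hba, h, h1, h2]
        simp
    · have h1 : b ≠ a := by rintro rfl; exact hba List.prefix_rfl
      have h2 : ∀ j, ¬ (a ++ [j] <+: b) := fun j h =>
        hba ((List.prefix_append _ _).trans h)
      simp only [Set.indicator, Set.mem_inter_iff, wedge, Set.mem_ofPred_eq,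
          Set.mem_singleton_iff, hbS, hba, h1, h2]
      simp
  · simp [Set.indicator, hbS]

lemma child_sum_le {x : DyadicNode → ℝ} (hx : MemJT x) (hpos : ∀ a, 0 ≤ x a)
    {S : Set DyadicNode} (hS : IsSegment S) (c : DyadicNode) :
    segSum x (S ∩ wedge c) ≤ maxSum x c := by
  obtain ⟨s, -, -, -, -, h⟩ := exists_max hx hpos c
  exact h _ (isSegment_inter_wedge hS c) (fun b hb => hb.2)

open Classical in
lemma upper_bound {x : DyadicNode → ℝ} (hx : MemJT x) (hpos : ∀ a, 0 ≤ x a)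
    (a : DyadicNode) (i : Bool) {M : ℝ} (hM : maxSum x (a ++ [i]) ≤ M)
    (hM' : maxSum x (a ++ [!i]) ≤ M) :
    JTnormSq ((wedge a).indicator x) ≤ (x a) ^ 2 + 2 * x a * M
      + (JTnormSq ((wedge (a ++ [i])).indicator x)
        + JTnormSq ((wedge (a ++ [!i])).indicator x)) := by
  have hM0 : 0 ≤ M := by
    have := child_sum_le hx hpos isSegment_empty (a ++ [i])
    rw [Set.empty_inter, segSum_empty] at this
    linarith
  have hD : 0 ≤ (x a) ^ 2 + 2 * x a * M := by
    have := mul_nonneg (hpos a) hM0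
    nlinarith [sq_nonneg (x a)]
  have hne : (normSqSet ((wedge a).indicator x)).Nonempty :=
    ⟨_, ∅, ⟨by simp, by simp⟩, rfl⟩
  apply csSup_le hne
  rintro r ⟨P, hP, rfl⟩
  apply pNormSq_le_of
  intro F
  have hdisj : ∀ S ∈ F, ∀ T ∈ F, S ≠ T → Disjoint (S : Set DyadicNode) (T : Set DyadicNode) :=
    fun S _ T _ hne => hP.2 S.2 T.2 (fun h => hne (Subtype.ext h))
  have h1 := fam_le (bdd_indicator hx.1 (a ++ [i])) F (fun S => (S : Set DyadicNode))
    (fun S _ => hP.1 S S.2) hdisj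
  have h2 := fam_le (bdd_indicator hx.1 (a ++ [!i])) F (fun S => (S : Set DyadicNode))
    (fun S _ => hP.1 S S.2) hdisj
  have h3 : ∑ S ∈ F, (if a ∈ (S : Set DyadicNode) then (x a) ^ 2 + 2 * x a * M else 0)
      ≤ (x a) ^ 2 + 2 * x a * M := by
    by_cases hex : ∃ S ∈ F, a ∈ (S : Set DyadicNode)
    · obtain ⟨S, hSF, haS⟩ := hex
      rw [Finset.sum_eq_single_of_mem S hSF]
      · simp [haS]
      · intro T hT hne
        rw [if_neg]
        intro haT
        exact Set.disjoint_left.1 (hdisj T hT S hSF hne) haT haS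
    · push Not at hex
      rw [Finset.sum_eq_zero]
      · exact hD
      · intro S hS
        rw [if_neg (hex S hS)]
  refine le_trans ?_ (add_le_add h3 (add_le_add h1 h2))
  rw [← Finset.sum_add_distrib, ← Finset.sum_add_distrib]
  apply Finset.sum_le_sum
  intro S _
  have hS := hP.1 S S.2
  simp only [segSum_indicator]
  rw [segSum_split hx.1 hpos hS a i]
  have hu := (child_sum_le hx hpos hS (a ++ [i])).trans hM
  have hv := (child_sum_le hx hpos hS (a ++ [!i])).trans hM'
  have hxa := hpos a
  rcases seg_one_side hS a i with h | h
  · rw [h, segSum_empty]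
    split_ifs
    · nlinarith [mul_le_mul_of_nonneg_left hv hxa]
    · nlinarith
  · rw [h, segSum_empty]
    split_ifs
    · nlinarith [mul_le_mul_of_nonneg_left hu hxa]
    · nlinarith

lemma insert_segment {a : DyadicNode} {i : Bool} {s : Set DyadicNode} (hs : IsSegment s)
    (hmem : a ++ [i] ∈ s) (hc : ∀ b ∈ s, a ++ [i] <+: b) : IsSegment (insert a s) := by
  have hpre : ∀ b ∈ s, a <+: b := fun b hb => (List.prefix_append _ _).trans (hc b hb)
  constructor
  · rintro u (rfl | hu) v (rfl | hv)
    · exact Or.inl List.prefix_rfl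
    · exact Or.inl (hpre v hv)
    · exact Or.inr (hpre u hu)
    · exact hs.1 u hu v hv
  · rintro u (rfl | hu) v (rfl | hv) e hue hev
    · left
      exact (hue.eq_of_length (le_antisymm hue.length_le hev.length_le)).symm
    · rcases child_cases i hue with rfl | h | h
      · exact Or.inl rfl
      · exact Or.inr (hs.2 _ hmem v hv e h hev)
      · exact (child_ne (hc v hv) (List.IsPrefix.trans h hev)).elim
    · exact (self_not_child ((hc u hu).trans (hue.trans hev))).elim
    · exact Or.inr (hs.2 u hu v hv e hue hev)

open Classical in
lemma lower_bound {x : DyadicNode → ℝ} (hx : MemJT x) (hpos : ∀ a, 0 ≤ x a)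
    (a : DyadicNode) (i : Bool) {s : Set DyadicNode} (hs : IsSegment s)
    (hmem : a ++ [i] ∈ s) (hc : ∀ b ∈ s, a ++ [i] <+: b)
    {P Q : Set (Set DyadicNode)} (hP : IsPartition P) (hQ : IsPartition Q) (hsP : s ∈ P) :
    (x a) ^ 2 + 2 * x a * segSum x s + (pNormSq ((wedge (a ++ [i])).indicator x) P
      + pNormSq ((wedge (a ++ [!i])).indicator x) Q) ≤ JTnormSq ((wedge a).indicator x) := by
  have hsW : s ∩ wedge (a ++ [i]) = s := Set.inter_eq_left.2 hc
  have hw : ∀ j, wedge (a ++ [j]) ⊆ wedge a := fun j b hb =>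
    (List.prefix_append _ _).trans hb
  have hins := insert_segment hs hmem hc
  have hinsW : insert a s ∩ wedge a = insert a s := by
    apply Set.inter_eq_left.2
    rintro b (rfl | hb)
    · exact List.prefix_rfl
    · exact hw i (hc b hb)
  have has : a ∉ s := fun h => self_not_child (hc a h)
  have hsum : segSum x (insert a s) = x a + segSum x s := by
    have := segSum_split hx.1 hpos hins a i
    rw [hinsW, if_pos (Set.mem_insert _ _)] at this
    have e1 : insert a s ∩ wedge (a ++ [i]) = s := by
      ext b
      constructor
      · rintro ⟨rfl | hb, h⟩
        · exact (self_not_child h).elim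
        · exact hb
      · exact fun hb => ⟨Or.inr hb, hc b hb⟩
    have e2 : insert a s ∩ wedge (a ++ [!i]) = ∅ := by
      rcases seg_one_side hins a i with h | h
      · rw [e1] at h
        rw [h] at hmem
        exact hmem.elim
      · exact h
    rw [e1, e2, segSum_empty, add_zero] at this
    exact this
  let N : P ⊕ Q → Set DyadicNode := Sum.elim
    (fun S => if (S : Set DyadicNode) = s then insert a s
      else (S : Set DyadicNode) ∩ wedge (a ++ [i]))
    (fun S => (S : Set DyadicNode) ∩ wedge (a ++ [!i]))
  have hNl : ∀ S : P, N (Sum.inl S) ⊆ insert a ((S : Set DyadicNode) ∩ wedge (a ++ [i])) := by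
    intro S
    simp only [N, Sum.elim_inl]
    split_ifs with h
    · rw [h, hsW]
    · exact Set.subset_insert _ _
  have hNl' : ∀ S : P, (S : Set DyadicNode) ≠ s → a ∉ N (Sum.inl S) := by
    intro S h
    simp only [N, Sum.elim_inl, if_neg h]
    exact fun h => self_not_child h.2
  have hseg : ∀ k, IsSegment (N k) := by
    rintro (S | S)
    · simp only [N, Sum.elim_inl]
      split_ifs
      · exact hins
      · exact isSegment_inter_wedge (hP.1 S S.2) _
    · exact isSegment_inter_wedge (hQ.1 S S.2) _
  have hlr : ∀ S T, Disjoint (N (Sum.inl S)) (N (Sum.inr T)) := by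
    intro S T
    rw [Set.disjoint_left]
    rintro b hb ⟨-, hb2⟩
    rcases hNl S hb with rfl | hb
    · exact self_not_child hb2
    · exact child_ne hb.2 hb2
  have hdisj : ∀ k l, k ≠ l → Disjoint (N k) (N l) := by
    rintro (S | S) (T | T) hne
    · have hne' : (S : Set DyadicNode) ≠ T := fun h => hne (by rw [Subtype.ext h])
      have hd := Set.disjoint_left.1 (hP.2 S.2 T.2 hne')
      rw [Set.disjoint_left]
      intro b hbS hbT
      by_cases hba : b = a
      · subst hba
        by_cases h : (S : Set DyadicNode) = s
        · exact hNl' T (fun h' => hne' (h.trans h'.symm)) hbT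
        · exact hNl' S h hbS
      · exact hd ((hNl S hbS).resolve_left hba).1 ((hNl T hbT).resolve_left hba).1
    · exact hlr S T
    · exact (hlr T S).symm
    · have hne' : (S : Set DyadicNode) ≠ T := fun h => hne (by rw [Subtype.ext h])
      exact Disjoint.mono Set.inter_subset_left Set.inter_subset_left (hQ.2 S.2 T.2 hne')
  set D := (x a) ^ 2 + 2 * x a * segSum x s with hD
  set J := JTnormSq ((wedge a).indicator x) with hJ
  have hvalr : ∀ T : Q, segSum ((wedge a).indicator x) (N (Sum.inr T))
      = segSum ((wedge (a ++ [!i])).indicator x) T := by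
    intro T
    rw [segSum_indicator, segSum_indicator]
    simp only [N, Sum.elim_inr]
    rw [Set.inter_assoc, Set.inter_eq_left.2 (hw _)]
  have hvall : ∀ S : P, (segSum ((wedge a).indicator x) (N (Sum.inl S))) ^ 2
      = (segSum ((wedge (a ++ [i])).indicator x) S) ^ 2
        + if S = (⟨s, hsP⟩ : P) then D else 0 := by
    intro S
    rw [segSum_indicator, segSum_indicator]
    by_cases h : (S : Set DyadicNode) = s
    · have h' : S = (⟨s, hsP⟩ : P) := Subtype.ext h
      simp only [N, Sum.elim_inl, if_pos h, if_pos h']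
      rw [hinsW, hsum, h, hsW, hD]
      ring
    · have h' : S ≠ (⟨s, hsP⟩ : P) := fun e => h (congrArg Subtype.val e)
      simp only [N, Sum.elim_inl, if_neg h, if_neg h']
      rw [Set.inter_assoc, Set.inter_eq_left.2 (hw _), add_zero]
  have hfin : ∀ (F : Finset P) (G : Finset Q),
      ∑ S ∈ F, (segSum ((wedge (a ++ [i])).indicator x) S) ^ 2
        + ∑ T ∈ G, (segSum ((wedge (a ++ [!i])).indicator x) T) ^ 2 ≤ J - D := by
    intro F G
    have := fam_le (bdd_indicator hx.1 a) ((insert (⟨s, hsP⟩ : P) F).disjSum G) N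
      (fun k _ => hseg k) (fun k _ l _ h => hdisj k l h)
    rw [Finset.sum_disjSum] at this
    simp only [hvalr, hvall] at this
    rw [Finset.sum_add_distrib, Finset.sum_ite_eq', if_pos (Finset.mem_insert_self _ _)] at this
    have hmono : ∑ S ∈ F, (segSum ((wedge (a ++ [i])).indicator x) S) ^ 2
        ≤ ∑ S ∈ insert (⟨s, hsP⟩ : P) F, (segSum ((wedge (a ++ [i])).indicator x) S) ^ 2 :=
      Finset.sum_le_sum_of_subset_of_nonneg (Finset.subset_insert _ _)
        (fun _ _ _ => sq_nonneg _)
    linarith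
  have hG : ∀ G : Finset Q, pNormSq ((wedge (a ++ [i])).indicator x) P
      ≤ J - D - ∑ T ∈ G, (segSum ((wedge (a ++ [!i])).indicator x) T) ^ 2 := by
    intro G
    apply pNormSq_le_of
    intro F
    linarith [hfin F G]
  have hQle : pNormSq ((wedge (a ++ [!i])).indicator x) Q
      ≤ J - D - pNormSq ((wedge (a ++ [i])).indicator x) P := by
    apply pNormSq_le_of
    intro G
    linarith [hG G]
  linarith

lemma step_aux (x : DyadicNode → ℝ) (hx : MemJT x)
    (hpos : ∀ a, 0 ≤ x a) (a : DyadicNode) (i : Bool)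
    (hchild : ∀ j, ∀ s_c : Set DyadicNode,
      IsSegment s_c → a ++ [j] ∈ s_c → (∀ b ∈ s_c, a ++ [j] <+: b) →
      segSum x s_c = maxSum x (a ++ [j]) →
      ∃ P : Set (Set DyadicNode),
        IsNormingPartition ((wedge (a ++ [j])).indicator x) P ∧ s_c ∈ P)
    (hmax : maxSum x (a ++ [!i]) ≤ maxSum x (a ++ [i])) :
    JTnormSq ((wedge a).indicator x)
      = (x a) ^ 2 + 2 * x a * maxSum x (a ++ [i])
        + (JTnormSq ((wedge (a ++ [i])).indicator x)
            + JTnormSq ((wedge (a ++ [!i])).indicator x)) := by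
  apply le_antisymm (upper_bound hx hpos a i le_rfl hmax)
  obtain ⟨s, hs, hsm, hsc, hse, -⟩ := exists_max hx hpos (a ++ [i])
  obtain ⟨t, ht, htm, htc, hte, -⟩ := exists_max hx hpos (a ++ [!i])
  obtain ⟨P, hP, hsP⟩ := hchild i s hs hsm hsc hse
  obtain ⟨Q, hQ, -⟩ := hchild (!i) t ht htm htc hte
  rw [← hP.2, ← hQ.2, ← hse]
  exact lower_bound hx hpos a i hs hsm hsc hP.1 hQ.1 hsP

/-- Recursive norm formula at a node `a` of the support of a positive
vector `x ∈ JT`: if for every child `c` of `a` and every segment `s_c ⊆ W_c` with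
`min s_c = c` and `S_{s_c}(x) = S_c(x)` there is an `x_c`-norming partition containing
`s_c`, then `‖x_a‖² = x(a)² + 2·x(a)·S_{c₀}(x) + ∑_c ‖x_c‖²`, where `c₀` is a child of `a`
maximizing `S_{c₀}(x)`. -/
theorem greedy_recursive_step (x : DyadicNode → ℝ) (hx : MemJT x)
    (hpos : ∀ a, 0 ≤ x a) (a : DyadicNode) (ha : a ∈ Function.support x)
    (hchild : ∀ c ∈ children a, ∀ s_c : Set DyadicNode,
      IsSegment s_c → s_c ⊆ wedge c → c ∈ s_c → (∀ b ∈ s_c, c <+: b) →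
      segSum x s_c = maxSum x c →
      ∃ P : Set (Set DyadicNode),
        IsNormingPartition ((wedge c).indicator x) P ∧ s_c ∈ P)
    (c₀ : DyadicNode) (hc₀ : c₀ ∈ children a)
    (hmax : ∀ c ∈ children a, maxSum x c ≤ maxSum x c₀) :
    (JTnorm ((wedge a).indicator x)) ^ 2
      = (x a) ^ 2 + 2 * x a * maxSum x c₀
        + ((JTnorm ((wedge (a ++ [false])).indicator x)) ^ 2
            + (JTnorm ((wedge (a ++ [true])).indicator x)) ^ 2) := by
  rw [JTnorm_sq, JTnorm_sq, JTnorm_sq]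
  have hj : ∀ j, a ++ [j] ∈ children a := by
    intro j
    cases j <;> simp [children]
  have hch : ∀ j, ∀ s_c : Set DyadicNode,
      IsSegment s_c → a ++ [j] ∈ s_c → (∀ b ∈ s_c, a ++ [j] <+: b) →
      segSum x s_c = maxSum x (a ++ [j]) →
      ∃ P : Set (Set DyadicNode),
        IsNormingPartition ((wedge (a ++ [j])).indicator x) P ∧ s_c ∈ P :=
    fun j s h1 h2 h3 h4 => hchild _ (hj j) s h1 h3 h2 h3 h4
  rcases hc₀ with h | h
  · subst h
    exact step_aux x hx hpos a false hch (hmax _ (hj _))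
  · rw [Set.mem_singleton_iff] at h
    subst h
    have := step_aux x hx hpos a true hch (hmax _ (hj _))
    rw [this]
    simp only [Bool.not_true]
    ring

end JTSpace
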